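/- There is no continuous map on the unit sphere S² ⊂ R³ assigning to each point x a 3-cross (an unordered triple of mutually orthogonal lines in R³) that contains the line through the normal x at every point. Equivalently (via Poincaré–Hopf), a continuous choice of such a 3-cross field on all of S² would induce a nowhere-vanishing continuous tangent vector field on S² minus a finite set after any lift, contradicting the Hairy Ball theorem on all of S². -/

import Mathlib

open Matrix BigOperators

namespace ThreeCross

open Complex

/-- A continuous complex function with constant exponential on a preconnected space is constant. -/
theorem eq_of_exp_eq_const {A : Type*} [TopologicalSpace A] [PreconnectedSpace A] {D : A → ℂ}
    (hD : Continuous D) {c : ℂ} (h : ∀ a, exp (D a) = c) (a b : A) : D a = D b := by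
  refine isCoveringMap_exp.const_of_comp hD (fun a b ↦ ?_) a b
  simp [h]

/-- A nowhere vanishing continuous function on the plane has a continuous logarithm. -/
theorem exists_continuous_log {F : ℝ × ℝ → ℂ} (hF : Continuous F) (h0 : ∀ p, F p ≠ 0) :
    ∃ L : ℝ × ℝ → ℂ, Continuous L ∧ ∀ p, exp (L p) = F p := by
  obtain ⟨L, ⟨-, hL⟩, -⟩ := isCoveringMapOn_exp.existsUnique_continuousMap_lifts
    (⟨F, hF⟩ : C(ℝ × ℝ, ℂ)) (a₀ := 0) (e₀ := log (F 0)) (exp_log (h0 0)) h0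
  exact ⟨L, L.continuous, fun p ↦ congrFun hL p⟩

/-- The winding number is a homotopy invariant: a nowhere vanishing function on a periodic strip
restricting to `exp (m * φ * I)` and `exp (n * φ * I)` (up to constants) on two circles forces
`m = n`. -/
theorem winding_eq {F : ℝ × ℝ → ℂ} (hF : Continuous F) (h0 : ∀ p, F p ≠ 0)
    (hper : ∀ s φ, F (s, φ + 2 * Real.pi) = F (s, φ)) {s t : ℝ} {m n : ℂ}
    (hs : ∀ φ : ℝ, F (s, φ) = exp (m * φ * I) * F (s, 0))
    (ht : ∀ φ : ℝ, F (t, φ) = exp (n * φ * I) * F (t, 0)) : m = n := by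
  obtain ⟨L, hL, hexp⟩ := exists_continuous_log hF h0
  have increment {r : ℝ} {k : ℂ} (hr : ∀ φ : ℝ, F (r, φ) = exp (k * φ * I) * F (r, 0)) :
      L (r, 0 + 2 * Real.pi) - L (r, 0) = k * (2 * Real.pi) * I := by
    have := eq_of_exp_eq_const (D := fun φ : ℝ ↦ L (r, φ) - k * φ * I) (by fun_prop)
      (c := F (r, 0))
      (fun φ ↦ by rw [exp_sub, hexp, hr φ, mul_div_cancel_left₀ _ (exp_ne_zero _)])
      (0 + 2 * Real.pi) 0
    push_cast at this
    linear_combination this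
  have hconst := eq_of_exp_eq_const
    (D := fun p : ℝ × ℝ ↦ L (p.1, p.2 + 2 * Real.pi) - L (p.1, p.2)) (by fun_prop) (c := 1)
    (fun p ↦ by rw [exp_sub, hexp, hexp, hper, div_self (h0 _)]) (s, 0) (t, 0)
  simp only [increment hs, increment ht] at hconst
  have hpi : (2 * Real.pi : ℂ) ≠ 0 := by simp [Real.pi_ne_zero]
  exact mul_right_cancel₀ hpi (mul_right_cancel₀ I_ne_zero hconst)

/-- The quartic form attached to a flattened 4-tensor. -/
def quartic (M : Matrix (Fin 3 × Fin 3) (Fin 3 × Fin 3) ℝ) (z : Fin 3 → ℂ) : ℂ :=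
  ∑ p, ∑ q, (M p q : ℂ) * (z p.1 * z p.2 * z q.1 * z q.2)

theorem quartic_smul (M : Matrix (Fin 3 × Fin 3) (Fin 3 × Fin 3) ℝ) (c : ℂ) (z : Fin 3 → ℂ) :
    quartic M (c • z) = c ^ 4 * quartic M z := by
  simp only [quartic, Finset.mul_sum, Pi.smul_apply, smul_eq_mul]
  exact Finset.sum_congr rfl fun p _ ↦ Finset.sum_congr rfl fun q _ ↦ by ring

theorem quartic_eq_sum_pow {M : Matrix (Fin 3 × Fin 3) (Fin 3 × Fin 3) ℝ} {a : Fin 3 → Fin 3 → ℝ}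
    (h : ∀ p q : Fin 3 × Fin 3, M p q = ∑ k : Fin 3, a k p.1 * a k q.1 * a k p.2 * a k q.2)
    (z : Fin 3 → ℂ) : quartic M z = ∑ k, (∑ i, (a k i : ℂ) * z i) ^ 4 := by
  have hpow (k : Fin 3) : (∑ i, (a k i : ℂ) * z i) ^ 4 =
      ∑ p : Fin 3 × Fin 3, ∑ q : Fin 3 × Fin 3,
        ((a k p.1 * z p.1) * (a k p.2 * z p.2)) * ((a k q.1 * z q.1) * (a k q.2 * z q.2)) := by
    have hsq : (∑ i, (a k i : ℂ) * z i) * (∑ i, (a k i : ℂ) * z i) =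
        ∑ p : Fin 3 × Fin 3, (a k p.1 * z p.1) * (a k p.2 * z p.2) := by
      rw [Fintype.sum_mul_sum, Fintype.sum_prod_type]
    rw [show ∀ s : ℂ, s ^ 4 = (s * s) * (s * s) by intro s; ring, hsq, Fintype.sum_mul_sum]
  simp only [hpow, quartic, h]
  conv_rhs => rw [Finset.sum_comm]
  refine Finset.sum_congr rfl fun p _ ↦ ?_
  conv_rhs => rw [Finset.sum_comm]
  refine Finset.sum_congr rfl fun q _ ↦ ?_
  push_cast
  rw [Finset.sum_mul]
  exact Finset.sum_congr rfl fun k _ ↦ by ring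

/-- The quartic form of an orthonormal frame does not vanish at a nonzero isotropic vector
orthogonal to one of the frame vectors. -/
theorem sum_pow_four_ne_zero {a : Fin 3 → Fin 3 → ℝ}
    (ha : ∀ k l, a k ⬝ᵥ a l = if k = l then (1 : ℝ) else 0) {z : Fin 3 → ℂ} (hz : z ≠ 0)
    (hiso : ∑ i, z i * z i = 0) {k : Fin 3} (hk : ∑ i, (a k i : ℂ) * z i = 0) :
    ∑ k, (∑ i, (a k i : ℂ) * z i) ^ 4 ≠ 0 := by
  let A : Matrix (Fin 3) (Fin 3) ℂ := of fun i j ↦ (a i j : ℂ)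
  have hAAt : A * Aᵀ = 1 := by
    ext i j
    have := congrArg (fun r : ℝ ↦ (r : ℂ)) (ha i j)
    simp only [dotProduct, ofReal_sum, ofReal_mul] at this
    rw [mul_apply, one_apply]
    simp only [A, transpose_apply, of_apply, this]
    split_ifs <;> simp
  have hAtA : Aᵀ * A = 1 := mul_eq_one_comm.mp hAAt
  set w : Fin 3 → ℂ := A *ᵥ z with hw
  have hwz (l : Fin 3) : ∑ i, (a l i : ℂ) * z i = w l := rfl
  have hback : Aᵀ *ᵥ w = z := by rw [hw, mulVec_mulVec, hAtA, one_mulVec]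
  have hww : w ⬝ᵥ w = 0 := by
    have : w ⬝ᵥ w = z ⬝ᵥ z := by
      rw [dotProduct_mulVec, ← mulVec_transpose, hback]
    exact this.trans hiso
  simp only [hwz] at hk ⊢
  intro h4
  apply hz
  have hw0 : w = 0 := by
    simp only [dotProduct, Fin.sum_univ_three] at hww h4
    have key : ∀ u v : ℂ, u * u + v * v = 0 → u ^ 4 + v ^ 4 = 0 → u = 0 ∧ v = 0 := by
      intro u v h h'
      have hu : u ^ 4 = 0 := by linear_combination h' / 2 + (u * u - v * v) / 2 * h
      have hv : v ^ 4 = 0 := by linear_combination h' - hu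
      exact ⟨pow_eq_zero_iff (by norm_num) |>.mp hu, pow_eq_zero_iff (by norm_num) |>.mp hv⟩
    ext i
    fin_cases k <;> simp only [Fin.zero_eta, Fin.mk_one, Fin.reduceFinMk] at hk <;>
      simp only [hk] at hww h4
    · have := key (w 1) (w 2) (by linear_combination hww) (by linear_combination h4)
      fin_cases i <;> simp [hk, this]
    · have := key (w 0) (w 2) (by linear_combination hww) (by linear_combination h4)
      fin_cases i <;> simp [hk, this]
    · have := key (w 0) (w 1) (by linear_combination hww) (by linear_combination h4)
      fin_cases i <;> simp [hk, this]
  rw [← hback, hw0, mulVec_zero]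

/-- Spherical coordinates `(θ, φ)` on the unit sphere. -/
noncomputable def spherePoint (p : ℝ × ℝ) : Metric.sphere (0 : EuclideanSpace ℝ (Fin 3)) 1 :=
  ⟨!₂[Real.sin p.1 * Real.cos p.2, Real.sin p.1 * Real.sin p.2, Real.cos p.1], by
    rw [mem_sphere_zero_iff_norm, EuclideanSpace.norm_eq, Real.sqrt_eq_one]
    simp only [Fin.sum_univ_three, Real.norm_eq_abs, sq_abs]
    simp
    linear_combination Real.sin_sq_add_cos_sq p.1 +
      Real.sin p.1 ^ 2 * Real.sin_sq_add_cos_sq p.2⟩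

theorem continuous_spherePoint : Continuous spherePoint := by
  unfold spherePoint
  refine Continuous.subtype_mk ((PiLp.continuous_toLp 2 _).comp (continuous_pi fun i ↦ ?_)) _
  fin_cases i <;> simp <;> fun_prop

/-- The complex tangent vector `e_θ + i e_φ`. -/
noncomputable def tangent (p : ℝ × ℝ) : Fin 3 → ℂ :=
  ![Real.cos p.1 * Real.cos p.2 - I * Real.sin p.2,
    Real.cos p.1 * Real.sin p.2 + I * Real.cos p.2, -Real.sin p.1]

theorem continuous_tangent : Continuous tangent := by
  refine continuous_pi fun i ↦ ?_
  fin_cases i <;> simp [tangent, -ofReal_cos, -ofReal_sin] <;> fun_prop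

theorem tangent_isotropic (p : ℝ × ℝ) : ∑ i, tangent p i * tangent p i = 0 := by
  simp only [tangent, Fin.sum_univ_three]
  simp
  linear_combination (cos p.1 ^ 2 + I ^ 2) * sin_sq_add_cos_sq (p.2 : ℂ) +
    sin_sq_add_cos_sq (p.1 : ℂ) + I_sq

theorem tangent_orthogonal (p : ℝ × ℝ) :
    ∑ i, (((spherePoint p : EuclideanSpace ℝ (Fin 3)) i : ℝ) : ℂ) * tangent p i = 0 := by
  simp only [tangent, spherePoint, Fin.sum_univ_three]
  simp
  linear_combination sin p.1 * cos p.1 * sin_sq_add_cos_sq (p.2 : ℂ)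

theorem tangent_ne_zero (p : ℝ × ℝ) : tangent p ≠ 0 := by
  intro h
  have h0 := congrArg im (congrFun h 0)
  have h1 := congrArg im (congrFun h 1)
  simp [tangent, -ofReal_cos, -ofReal_sin] at h0 h1
  simpa [h0, h1] using Real.sin_sq_add_cos_sq p.2

theorem tangent_zero_left (φ : ℝ) : tangent (0, φ) = exp (-φ * I) • tangent (0, 0) := by
  rw [exp_mul_I]
  ext i
  fin_cases i <;> simp [tangent]
  · ring
  · linear_combination sin (φ : ℂ) * I_sq

theorem tangent_pi_left (φ : ℝ) :
    tangent (Real.pi, φ) = exp (φ * I) • tangent (Real.pi, 0) := by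
  rw [exp_mul_I]
  ext i
  fin_cases i <;> simp [tangent]
  · ring
  · linear_combination -sin (φ : ℂ) * I_sq

theorem spherePoint_congr_of_sin_eq_zero {θ : ℝ} (h : Real.sin θ = 0) (φ ψ : ℝ) :
    spherePoint (θ, φ) = spherePoint (θ, ψ) := by
  simp [spherePoint, h]

end ThreeCross

open ThreeCross in
theorem stmt14 :
    ¬ ∃ Q : Metric.sphere (0 : EuclideanSpace ℝ (Fin 3)) 1 →
        Matrix (Fin 3 × Fin 3) (Fin 3 × Fin 3) ℝ,
      Continuous Q ∧
      ∀ x : Metric.sphere (0 : EuclideanSpace ℝ (Fin 3)) 1,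
        ∃ a : Fin 3 → Fin 3 → ℝ,
          (∀ k l, a k ⬝ᵥ a l = if k = l then (1 : ℝ) else 0) ∧
          (∃ k, (∀ i, a k i = (x : EuclideanSpace ℝ (Fin 3)) i) ∨
                (∀ i, a k i = -((x : EuclideanSpace ℝ (Fin 3)) i))) ∧
          (∀ p q : Fin 3 × Fin 3,
            Q x p q = ∑ k : Fin 3, a k p.1 * a k q.1 * a k p.2 * a k q.2) := by
  rintro ⟨Q, hQ, hcross⟩
  have hF : Continuous fun p ↦ quartic (Q (spherePoint p)) (tangent p) := by
    have hS := continuous_spherePoint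
    have hT := continuous_tangent
    have hQS := hQ.comp hS
    refine continuous_finsetSum _ fun p _ ↦ continuous_finsetSum _ fun q _ ↦ ?_
    exact (Complex.continuous_ofReal.comp (hQS.matrix_elem p q)).mul (by fun_prop)
  have h0 (p : ℝ × ℝ) : quartic (Q (spherePoint p)) (tangent p) ≠ 0 := by
    obtain ⟨a, ha, ⟨k, hk⟩, hM⟩ := hcross (spherePoint p)
    rw [quartic_eq_sum_pow hM]
    refine sum_pow_four_ne_zero ha (tangent_ne_zero p) (tangent_isotropic p) (k := k) ?_
    rcases hk with hk | hk <;> simp [hk, tangent_orthogonal]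
  have hmn := winding_eq hF h0 (s := 0) (t := Real.pi) (m := -4) (n := 4)
    (fun s φ ↦ by simp [spherePoint, tangent])
    (fun φ ↦ by
      rw [tangent_zero_left, quartic_smul, spherePoint_congr_of_sin_eq_zero Real.sin_zero φ 0,
        ← Complex.exp_nat_mul]
      congr 2
      push_cast
      ring)
    (fun φ ↦ by
      rw [tangent_pi_left, quartic_smul, spherePoint_congr_of_sin_eq_zero Real.sin_pi φ 0,
        ← Complex.exp_nat_mul]
      congr 2
      push_cast
      ring)
  norm_num at hmn
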